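/- Let V₁, V₂, V₃ be complex vector spaces with sl₂-actions and v_i ∈ V_i primitive of weights m_i (nonnegative integers) with f^{m_i+1} v_i = 0. Let r be a nonnegative integer. Then for every admissible r₁: Ω₂₃ W_{r₁} = (r−r₁+1)(m₃−r+r₁)·W_{r₁−1} + b_{r₁}·W_{r₁} + γ_{r₁}·W_{r₁+1}, where b_{r₁} = m₂(m₃−2r)/2 + r₁(m₂−m₃+2r−2r₁) + r₁(m₂−r₁+1)(r−r₁+1)(m₃−r+r₁)/(m₁+m₂−2r₁+2) − (r₁+1)(m₂−r₁)(r−r₁)(m₃−r+r₁+1)/(m₁+m₂−2r₁) and γ_{r₁} = (r₁+1)(m₁−r₁)(m₂−r₁)(m₁+m₂−r₁+1)(m₁+m₂−r−r₁)(m₁+m₂+m₃−r−r₁+1) / ((m₁+m₂−2r₁−1)(m₁+m₂−2r₁)²(m₁+m₂−2r₁+1)), with W_{r₁±1} := 0 when r₁±1 is not admissible. -/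

import Mathlib

open scoped TensorProduct

/-- An sl₂-action on a complex vector space `V`. -/
def IsSl2Action {V : Type*} [AddCommGroup V] [Module ℂ V]
    (e f h : Module.End ℂ V) : Prop :=
  h ∘ₗ e - e ∘ₗ h = (2 : ℂ) • e ∧ h ∘ₗ f - f ∘ₗ h = (-2 : ℂ) • f ∧ e ∘ₗ f - f ∘ₗ e = h

/-- The falling factorial `(x)_n = x(x−1)⋯(x−n+1)`, with `(x)_0 = 1`. -/
noncomputable def fallFac (x : ℂ) (n : ℕ) : ℂ := ∏ i ∈ Finset.range n, (x - i)

/-- `r₁` is admissible for `(m₁, m₂, m₃, r)` when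
`max(0, r−m₃) ≤ r₁ ≤ min(r, min(m₁,m₂), m₁+m₂−r)`. -/
def Admissible (m₁ m₂ m₃ r : ℕ) (k : ℤ) : Prop :=
  (r : ℤ) - (m₃ : ℤ) ≤ k ∧ 0 ≤ k ∧ k ≤ (r : ℤ) ∧ k ≤ (m₁ : ℤ) ∧ k ≤ (m₂ : ℤ) ∧
    k ≤ (m₁ : ℤ) + (m₂ : ℤ) - (r : ℤ)

/-- The coefficient `C^{r₁}_{i,j}` from the Shapovalov basis formula. -/
noncomputable def Ccoef (m₁ m₂ m₃ r r₁ i j : ℕ) : ℂ :=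
  (1 / (fallFac (m₁ : ℂ) i * fallFac (m₂ : ℂ) (r₁ - i) *
      (Nat.factorial i : ℂ) * (Nat.factorial (r₁ - i) : ℂ))) *
  (1 / (fallFac ((m₁ : ℂ) + (m₂ : ℂ) - 2 * (r₁ : ℂ)) j * fallFac (m₃ : ℂ) (r - r₁ - j) *
      (Nat.factorial j : ℂ) * (Nat.factorial (r - r₁ - j) : ℂ)))

/-- The (unnormalized) Shapovalov basis vector
`W_{r₁} = Σᵢⱼ (−1)^{i+j} C^{r₁}_{i,j} · f^j(fⁱv₁ ⊗ f^{r₁−i}v₂) ⊗ f^{r−r₁−j}v₃`,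
where `f` acts diagonally on the first two tensor factors. -/
noncomputable def Wvec {V₁ V₂ V₃ : Type*} [AddCommGroup V₁] [Module ℂ V₁]
    [AddCommGroup V₂] [Module ℂ V₂] [AddCommGroup V₃] [Module ℂ V₃]
    (f₁ : Module.End ℂ V₁) (f₂ : Module.End ℂ V₂) (f₃ : Module.End ℂ V₃)
    (v₁ : V₁) (v₂ : V₂) (v₃ : V₃) (m₁ m₂ m₃ r r₁ : ℕ) : (V₁ ⊗[ℂ] V₂) ⊗[ℂ] V₃ :=
  ∑ i ∈ Finset.range (r₁ + 1), ∑ j ∈ Finset.range (r - r₁ + 1),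
    ((-1 : ℂ) ^ (i + j) * Ccoef m₁ m₂ m₃ r r₁ i j) •
      ((((LinearMap.rTensor V₂ f₁ + LinearMap.lTensor V₁ f₂ :
            Module.End ℂ (V₁ ⊗[ℂ] V₂)) ^ j)
          (((f₁ ^ i) v₁) ⊗ₜ[ℂ] ((f₂ ^ (r₁ - i)) v₂))) ⊗ₜ[ℂ] ((f₃ ^ (r - r₁ - j)) v₃))

open Classical in
/-- `W_k` extended to integer indices, with `W_k := 0` for non-admissible `k`. -/
noncomputable def WvecZ {V₁ V₂ V₃ : Type*} [AddCommGroup V₁] [Module ℂ V₁]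
    [AddCommGroup V₂] [Module ℂ V₂] [AddCommGroup V₃] [Module ℂ V₃]
    (f₁ : Module.End ℂ V₁) (f₂ : Module.End ℂ V₂) (f₃ : Module.End ℂ V₃)
    (v₁ : V₁) (v₂ : V₂) (v₃ : V₃) (m₁ m₂ m₃ r : ℕ) (k : ℤ) : (V₁ ⊗[ℂ] V₂) ⊗[ℂ] V₃ :=
  if Admissible m₁ m₂ m₃ r k then Wvec f₁ f₂ f₃ v₁ v₂ v₃ m₁ m₂ m₃ r k.toNat else 0

/-- The operator `Ω₂₃ = e ⊗ f + f ⊗ e + ½ h ⊗ h` acting on the second and third tensor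
factors of `V₁ ⊗ V₂ ⊗ V₃` and as the identity on `V₁`. -/
noncomputable def Omega23Triple {V₁ V₂ V₃ : Type*} [AddCommGroup V₁] [Module ℂ V₁]
    [AddCommGroup V₂] [Module ℂ V₂] [AddCommGroup V₃] [Module ℂ V₃]
    (e₂ f₂ h₂ : Module.End ℂ V₂) (e₃ f₃ h₃ : Module.End ℂ V₃) :
    Module.End ℂ ((V₁ ⊗[ℂ] V₂) ⊗[ℂ] V₃) :=
  TensorProduct.map (LinearMap.lTensor V₁ e₂) f₃ +
    TensorProduct.map (LinearMap.lTensor V₁ f₂) e₃ +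
    (2⁻¹ : ℂ) • TensorProduct.map (LinearMap.lTensor V₁ h₂) h₃

section Strings

variable {V : Type*} [AddCommGroup V] [Module ℂ V]

/-- The normalized string `fʲ v / ((m)_j j!)` through `v`. -/
noncomputable def divString (f : Module.End ℂ V) (v : V) (m : ℂ) (j : ℕ) : V :=
  (1 / (fallFac m j * (Nat.factorial j : ℂ))) • (f ^ j) v

/-- The backward shift of a sequence, with `0` in front. -/
def shiftSeq (U : ℕ → V) : ℕ → V
  | 0 => 0
  | j + 1 => U j

lemma fallFac_succ (x : ℂ) (n : ℕ) : fallFac x (n + 1) = fallFac x n * (x - n) :=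
  Finset.prod_range_succ _ _

lemma fallFac_natCast_ne_zero {m n : ℕ} (hn : n ≤ m) : fallFac (m : ℂ) n ≠ 0 := by
  refine Finset.prod_ne_zero_iff.2 fun i hi => ?_
  rw [sub_ne_zero]
  exact_mod_cast (by have := Finset.mem_range.1 hi; omega : m ≠ i)

lemma fallFac_natCast_eq_zero {m n : ℕ} (hn : m < n) : fallFac (m : ℂ) n = 0 :=
  Finset.prod_eq_zero (Finset.mem_range.2 hn) (sub_self _)

lemma divString_zero (f : Module.End ℂ V) (v : V) (m : ℂ) : divString f v m 0 = v := by
  simp [divString, fallFac]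

lemma divString_zero_vec (f : Module.End ℂ V) (m : ℂ) (j : ℕ) : divString f 0 m j = 0 := by
  simp [divString]

lemma divString_lower (f : Module.End ℂ V) (v : V) (m : ℕ) (hv : (f ^ (m + 1)) v = 0) (j : ℕ) :
    f (divString f v m j) = (((j : ℂ) + 1) * ((m : ℂ) - j)) • divString f v m (j + 1) := by
  have hstep : f ((f ^ j) v) = (f ^ (j + 1)) v := by rw [pow_succ']; rfl
  rw [divString, divString, map_smul, hstep, smul_smul]
  rcases lt_trichotomy j m with h | h | h
  · congr 1
    have h1 : fallFac (m : ℂ) j ≠ 0 := fallFac_natCast_ne_zero h.le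
    have h2 : (m : ℂ) - j ≠ 0 := by rw [sub_ne_zero]; exact_mod_cast h.ne'
    have h3 : (j : ℂ) + 1 ≠ 0 := by exact_mod_cast j.succ_ne_zero
    have h4 : (Nat.factorial j : ℂ) ≠ 0 := by exact_mod_cast j.factorial_ne_zero
    rw [fallFac_succ, Nat.factorial_succ]
    push_cast
    field_simp
  · subst h
    simp [hv]
  · simp [fallFac_natCast_eq_zero h, fallFac_natCast_eq_zero (h.trans j.lt_succ_self)]

lemma weight_pow {e f h : Module.End ℂ V} (hsl : IsSl2Action e f h) {v : V} {μ : ℂ}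
    (hh : h v = μ • v) (n : ℕ) : h ((f ^ n) v) = (μ - 2 * n) • (f ^ n) v := by
  induction n with
  | zero => simpa using hh
  | succ n ih =>
    have h1 := LinearMap.congr_fun hsl.2.1 ((f ^ n) v)
    simp only [LinearMap.sub_apply, LinearMap.comp_apply, LinearMap.smul_apply] at h1
    rw [pow_succ', Module.End.mul_apply, eq_add_of_sub_eq h1, ih, map_smul]
    push_cast
    module

lemma raise_pow {e f h : Module.End ℂ V} (hsl : IsSl2Action e f h) {v : V} {μ : ℂ}
    (he : e v = 0) (hh : h v = μ • v) (n : ℕ) :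
    e ((f ^ (n + 1)) v) = (((n : ℂ) + 1) * (μ - n)) • (f ^ n) v := by
  have key : ∀ x, e (f x) = f (e x) + h x := fun x => by
    have := LinearMap.congr_fun hsl.2.2 x
    simp only [LinearMap.sub_apply, LinearMap.comp_apply] at this
    rw [← this]; abel
  induction n with
  | zero => simp [key, he, hh]
  | succ n ih =>
    rw [pow_succ', Module.End.mul_apply, key, ih, weight_pow hsl hh, map_smul,
      ← Module.End.mul_apply, ← pow_succ']
    push_cast
    module

lemma divString_weight {e f h : Module.End ℂ V} (hsl : IsSl2Action e f h) {v : V} {μ : ℂ}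
    (hh : h v = μ • v) (j : ℕ) :
    h (divString f v μ j) = (μ - 2 * j) • divString f v μ j := by
  rw [divString, map_smul, weight_pow hsl hh, smul_comm]

lemma divString_raise {e f h : Module.End ℂ V} (hsl : IsSl2Action e f h) {v : V} {m : ℕ}
    (he : e v = 0) (hh : h v = (m : ℂ) • v) {j : ℕ} (hj : j ≤ m) :
    e (divString f v m j) = shiftSeq (divString f v m) j := by
  cases j with
  | zero => simp [divString_zero, shiftSeq, he]
  | succ j =>
    rw [divString, map_smul, raise_pow hsl he hh, smul_smul, shiftSeq, divString]
    congr 1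
    have h1 : fallFac (m : ℂ) j ≠ 0 := fallFac_natCast_ne_zero (by omega)
    have h2 : (m : ℂ) - j ≠ 0 := by rw [sub_ne_zero]; exact_mod_cast (by omega : m ≠ j)
    have h3 : (j : ℂ) + 1 ≠ 0 := by exact_mod_cast j.succ_ne_zero
    have h4 : (Nat.factorial j : ℂ) ≠ 0 := by exact_mod_cast j.factorial_ne_zero
    rw [fallFac_succ, Nat.factorial_succ]
    push_cast
    field_simp

/-- A primitive vector of weight `m` killed by some power of `f` is killed by `f ^ (m + 1)`. -/
lemma pow_succ_eq_zero_of_primitive {e f h : Module.End ℂ V} (hsl : IsSl2Action e f h) {v : V}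
    {m : ℕ} (he : e v = 0) (hh : h v = (m : ℂ) • v) {n : ℕ} (hn : (f ^ (m + 1 + n)) v = 0) :
    (f ^ (m + 1)) v = 0 := by
  induction n with
  | zero => exact hn
  | succ n ih =>
    refine ih ?_
    have h1 := raise_pow hsl he hh (m + 1 + n)
    rw [show m + 1 + n + 1 = m + 1 + (n + 1) by ring, hn, map_zero] at h1
    refine (smul_eq_zero.1 h1.symm).resolve_left (mul_ne_zero ?_ ?_)
    · exact_mod_cast (m + 1 + n).succ_ne_zero
    · rw [sub_ne_zero]
      exact_mod_cast (by omega : m ≠ m + 1 + n)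

/-- The action of a vector operator `(ae, af, ah)` along an `f`-string, deduced from its action on
the top vector of the string. -/
lemma vector_operator_string {f ae af ah : Module.End ℂ V} {Um U Up : ℕ → V} {N : ℕ} {β : ℂ}
    (haf : ∀ x, af (f x) = f (af x)) (hah : ∀ x, ah (f x) = f (ah x) - (2 : ℂ) • af x)
    (hae : ∀ x, ae (f x) = f (ae x) + ah x)
    (hUm : ∀ j : ℕ, f (Um j) = (((j : ℂ) + 1) * ((N : ℂ) + 2 - j)) • Um (j + 1))
    (hU : ∀ j : ℕ, f (U j) = (((j : ℂ) + 1) * ((N : ℂ) - j)) • U (j + 1))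
    (hUp : ∀ j : ℕ, f (Up j) = (((j : ℂ) + 1) * ((N : ℂ) - 2 - j)) • Up (j + 1))
    (hae0 : ae (U 0) = Um 0)
    (hah0 : ah (U 0) = (-2 : ℂ) • Um 1 + (β * N) • U 0)
    (haf0 : af (U 0) = (-2 : ℂ) • Um 2 + (β * N) • U 1 + ((N : ℂ) * (N - 1)) • Up 0)
    {j : ℕ} (hj : j ≤ N) :
    ae (U j) = Um j + β • shiftSeq U j - shiftSeq (shiftSeq Up) j ∧
    ah (U j) = (-2 * ((j : ℂ) + 1)) • Um (j + 1) + (β * (N - 2 * j)) • U j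
      + (-2 * ((N : ℂ) - j)) • shiftSeq Up j ∧
    af (U j) = (-(((j : ℂ) + 1) * (j + 2))) • Um (j + 2)
      + (β * (((j : ℂ) + 1) * (N - j))) • U (j + 1)
      + (((N : ℂ) - j) * (N - j - 1)) • Up j := by
  have hs1 : ∀ j : ℕ, f (shiftSeq Up j) = ((j : ℂ) * ((N : ℂ) - 1 - j)) • Up j := by
    rintro (_ | j)
    · simp [shiftSeq]
    · rw [shiftSeq, hUp]; push_cast; congr 1; ring
  have hs2 : ∀ j : ℕ, f (shiftSeq (shiftSeq Up) j)
      = (((j : ℂ) - 1) * ((N : ℂ) - j)) • shiftSeq Up j := by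
    rintro (_ | j)
    · simp [shiftSeq]
    · rw [shiftSeq, hs1, shiftSeq]; push_cast; congr 1; ring
  have hsU : ∀ j : ℕ, f (shiftSeq U j) = ((j : ℂ) * ((N : ℂ) + 1 - j)) • U j := by
    rintro (_ | j)
    · simp [shiftSeq]
    · rw [shiftSeq, hU]; push_cast; congr 1; ring
  induction j with
  | zero =>
    refine ⟨by simp [shiftSeq, hae0], by simp [shiftSeq, hah0], ?_⟩
    rw [haf0]
    push_cast
    simp
  | succ j ih =>
    obtain ⟨ihe, ihh, ihf⟩ := ih (by omega)
    have hc : ((j : ℂ) + 1) * ((N : ℂ) - j) ≠ 0 := by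
      refine mul_ne_zero (by exact_mod_cast j.succ_ne_zero) ?_
      rw [sub_ne_zero]
      exact_mod_cast (by omega : N ≠ j)
    have cancel : ∀ {x y : V}, (((j : ℂ) + 1) * ((N : ℂ) - j)) • x
        = (((j : ℂ) + 1) * ((N : ℂ) - j)) • y → x = y := fun h => smul_right_injective V hc h
    refine ⟨cancel ?_, cancel ?_, cancel ?_⟩
    · rw [← map_smul, ← hU, hae, ihe, ihh]
      simp only [map_add, map_sub, map_smul, hUm, hsU, hs2]
      simp only [shiftSeq]
      module
    · rw [← map_smul, ← hU, hah, ihh, ihf]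
      simp only [map_add, map_smul, hUm, hU, hs1]
      simp only [shiftSeq]
      push_cast
      module
    · rw [← map_smul, ← hU, haf, ihf]
      simp only [map_add, map_smul, hUm, hU, hUp]
      push_cast
      module

end Strings

open Finset

section Antidiagonal

variable {V : Type*} [AddCommGroup V]

lemma sum_antidiagonal_shift_left (G : ℕ → ℕ → V) (hG : ∀ c, G 0 c = 0) (n : ℕ) :
    ∑ p ∈ antidiagonal (n + 1), G p.1 p.2 = ∑ p ∈ antidiagonal n, G (p.1 + 1) p.2 := by
  rw [Finset.Nat.sum_antidiagonal_succ (f := fun p : ℕ × ℕ => G p.1 p.2)]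
  simp [hG]

lemma sum_antidiagonal_shift_right (G : ℕ → ℕ → V) (hG : ∀ j, G j 0 = 0) (n : ℕ) :
    ∑ p ∈ antidiagonal (n + 1), G p.1 p.2 = ∑ p ∈ antidiagonal n, G p.1 (p.2 + 1) := by
  rw [Finset.Nat.sum_antidiagonal_succ' (f := fun p : ℕ × ℕ => G p.1 p.2)]
  simp [hG]

end Antidiagonal

section AltSum

variable {A B : Type*} [AddCommGroup A] [Module ℂ A] [AddCommGroup B] [Module ℂ B]

/-- The alternating sum `Σ_{i+b=n} (-1)^i g(i,b) X_i ⊗ Y_b`. -/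
noncomputable def altSum (X : ℕ → A) (Y : ℕ → B) (g : ℂ → ℂ → ℂ) (n : ℕ) : A ⊗[ℂ] B :=
  ∑ p ∈ antidiagonal n, ((-1 : ℂ) ^ p.1 * g p.1 p.2) • (X p.1 ⊗ₜ[ℂ] Y p.2)

variable {X : ℕ → A} {Y : ℕ → B}

lemma altSum_congr {g g' : ℂ → ℂ → ℂ} {n : ℕ} (hg : ∀ x y : ℂ, x + y = n → g x y = g' x y) :
    altSum X Y g n = altSum X Y g' n := by
  refine Finset.sum_congr rfl fun p hp => ?_
  rw [hg]
  exact_mod_cast mem_antidiagonal.1 hp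

lemma altSum_add (g g' : ℂ → ℂ → ℂ) (n : ℕ) :
    altSum X Y g n + altSum X Y g' n = altSum X Y (fun x y => g x y + g' x y) n := by
  simp only [altSum, ← Finset.sum_add_distrib, ← add_smul, mul_add]

lemma altSum_smul (a : ℂ) (g : ℂ → ℂ → ℂ) (n : ℕ) :
    a • altSum X Y g n = altSum X Y (fun x y => a * g x y) n := by
  simp only [altSum, Finset.smul_sum, smul_smul, mul_left_comm]

lemma map_diag_shift_right {D : Module.End ℂ B} {φ : ℂ → ℂ}
    (hD : ∀ b : ℕ, D (Y b) = φ b • Y (b + 1)) (g : ℂ → ℂ → ℂ) (n : ℕ) (hφ : φ (-1) = 0) :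
    LinearMap.lTensor A D (altSum X Y g n)
      = altSum X Y (fun x y => φ (y - 1) * g x (y - 1)) (n + 1) := by
  rw [altSum, altSum, sum_antidiagonal_shift_right
    (fun i b => ((-1 : ℂ) ^ i * (φ (b - 1) * g i (b - 1))) • (X i ⊗ₜ[ℂ] Y b))
    (fun j => by simp [hφ]), map_sum]
  refine Finset.sum_congr rfl fun p _ => ?_
  rw [map_smul, LinearMap.lTensor_tmul, hD, TensorProduct.tmul_smul, smul_smul]
  congr 1
  push_cast
  rw [add_sub_cancel_right]
  ring

lemma map_diag_shift_left {D : Module.End ℂ A} {φ : ℂ → ℂ}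
    (hD : ∀ b : ℕ, D (X b) = φ b • X (b + 1)) (g : ℂ → ℂ → ℂ) (n : ℕ) (hφ : φ (-1) = 0) :
    LinearMap.rTensor B D (altSum X Y g n)
      = altSum X Y (fun x y => -(φ (x - 1) * g (x - 1) y)) (n + 1) := by
  rw [altSum, altSum, sum_antidiagonal_shift_left
    (fun i b => ((-1 : ℂ) ^ i * -(φ (i - 1) * g (i - 1) b)) • (X i ⊗ₜ[ℂ] Y b))
    (fun j => by simp [hφ]), map_sum]
  refine Finset.sum_congr rfl fun p _ => ?_
  rw [map_smul, LinearMap.rTensor_tmul, hD, ← TensorProduct.smul_tmul', smul_smul]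
  congr 1
  push_cast
  rw [add_sub_cancel_right]
  ring

lemma map_diag_right {D : Module.End ℂ B} {φ : ℂ → ℂ}
    (hD : ∀ b : ℕ, D (Y b) = φ b • Y b) (g : ℂ → ℂ → ℂ) (n : ℕ) :
    LinearMap.lTensor A D (altSum X Y g n) = altSum X Y (fun x y => φ y * g x y) n := by
  rw [altSum, altSum, map_sum]
  refine Finset.sum_congr rfl fun p _ => ?_
  rw [map_smul, LinearMap.lTensor_tmul, hD, TensorProduct.tmul_smul, smul_smul]
  congr 1
  ring

lemma map_diag_left {D : Module.End ℂ A} {φ : ℂ → ℂ}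
    (hD : ∀ b : ℕ, D (X b) = φ b • X b) (g : ℂ → ℂ → ℂ) (n : ℕ) :
    LinearMap.rTensor B D (altSum X Y g n) = altSum X Y (fun x y => φ x * g x y) n := by
  rw [altSum, altSum, map_sum]
  refine Finset.sum_congr rfl fun p _ => ?_
  rw [map_smul, LinearMap.rTensor_tmul, hD, ← TensorProduct.smul_tmul', smul_smul]
  congr 1
  ring

lemma map_raise_right {D : Module.End ℂ B} {n : ℕ}
    (hD : ∀ b ≤ n, D (Y b) = shiftSeq Y b) :
    LinearMap.lTensor A D (altSum X Y (fun _ _ => 1) n)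
      = shiftSeq (altSum X Y (fun _ _ => 1)) n := by
  have h1 : LinearMap.lTensor A D (altSum X Y (fun _ _ => 1) n)
      = ∑ p ∈ antidiagonal n, ((-1 : ℂ) ^ p.1) • (X p.1 ⊗ₜ[ℂ] shiftSeq Y p.2) := by
    rw [altSum, map_sum]
    refine Finset.sum_congr rfl fun p hp => ?_
    rw [map_smul, LinearMap.lTensor_tmul, hD _ (by have := mem_antidiagonal.1 hp; omega), mul_one]
  rw [h1]
  cases n with
  | zero => simp [shiftSeq]
  | succ n =>
    rw [sum_antidiagonal_shift_right
      (fun i b => ((-1 : ℂ) ^ i) • (X i ⊗ₜ[ℂ] shiftSeq Y b)) (by simp [shiftSeq])]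
    simp [shiftSeq, altSum]

lemma map_raise_left {D : Module.End ℂ A} {n : ℕ}
    (hD : ∀ b ≤ n, D (X b) = shiftSeq X b) :
    LinearMap.rTensor B D (altSum X Y (fun _ _ => 1) n)
      = -shiftSeq (altSum X Y (fun _ _ => 1)) n := by
  have h1 : LinearMap.rTensor B D (altSum X Y (fun _ _ => 1) n)
      = ∑ p ∈ antidiagonal n, ((-1 : ℂ) ^ p.1) • (shiftSeq X p.1 ⊗ₜ[ℂ] Y p.2) := by
    rw [altSum, map_sum]
    refine Finset.sum_congr rfl fun p hp => ?_
    rw [map_smul, LinearMap.rTensor_tmul, hD _ (by have := mem_antidiagonal.1 hp; omega), mul_one]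
  rw [h1]
  cases n with
  | zero => simp [shiftSeq]
  | succ n =>
    rw [sum_antidiagonal_shift_left
      (fun i b => ((-1 : ℂ) ^ i) • (shiftSeq X i ⊗ₜ[ℂ] Y b)) (by simp [shiftSeq])]
    simp [shiftSeq, altSum, pow_succ]

end AltSum
section AltSumShift

variable {A B : Type*} [AddCommGroup A] [Module ℂ A] [AddCommGroup B] [Module ℂ B]

lemma altSum_smul_left (a : ℂ) (X : ℕ → A) (Y : ℕ → B) (g : ℂ → ℂ → ℂ) (n : ℕ) :
    altSum (fun i => a • X i) Y g n = a • altSum X Y g n := by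
  simp only [altSum, Finset.smul_sum, TensorProduct.smul_tmul', smul_comm a]

lemma altSum_succ_right (X : ℕ → A) (Y : ℕ → B) (g : ℂ → ℂ → ℂ) (n : ℕ)
    (hg : ∀ x, g x (-1) = 0) :
    altSum X (fun b => Y (b + 1)) g n = altSum X Y (fun x y => g x (y - 1)) (n + 1) := by
  rw [altSum, altSum, sum_antidiagonal_shift_right
    (fun i b => ((-1 : ℂ) ^ i * g i (b - 1)) • (X i ⊗ₜ[ℂ] Y b)) (by simp [hg])]
  simp

lemma altSum_succ_left (X : ℕ → A) (Y : ℕ → B) (g : ℂ → ℂ → ℂ) (n : ℕ)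
    (hg : ∀ y, g (-1) y = 0) :
    altSum (fun a => X (a + 1)) Y g n = altSum X Y (fun x y => -g (x - 1) y) (n + 1) := by
  rw [altSum, altSum, sum_antidiagonal_shift_left
    (fun i b => ((-1 : ℂ) ^ i * -g (i - 1) b) • (X i ⊗ₜ[ℂ] Y b)) (by simp [hg])]
  simp [pow_succ]

lemma altSum_shift_right (X : ℕ → A) (Y : ℕ → B) (g : ℂ → ℂ → ℂ) (n : ℕ) :
    altSum X (shiftSeq Y) g (n + 1) = altSum X Y (fun x y => g x (y + 1)) n := by
  rw [altSum, altSum, sum_antidiagonal_shift_right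
    (fun i b => ((-1 : ℂ) ^ i * g i b) • (X i ⊗ₜ[ℂ] shiftSeq Y b)) (by simp [shiftSeq])]
  simp [shiftSeq]

lemma altSum_shift_left (X : ℕ → A) (Y : ℕ → B) (g : ℂ → ℂ → ℂ) (n : ℕ) :
    altSum (shiftSeq X) Y g (n + 1) = altSum X Y (fun x y => -g (x + 1) y) n := by
  rw [altSum, altSum, sum_antidiagonal_shift_left
    (fun i b => ((-1 : ℂ) ^ i * g i b) • (shiftSeq X i ⊗ₜ[ℂ] Y b)) (by simp [shiftSeq])]
  simp [shiftSeq, pow_succ]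

/-- The operator `ae ⊗ f + af ⊗ e + ½ ah ⊗ h` on alternating sums of strings, where
`(ae, af, ah)` is a vector operator as in `vector_operator_string`. -/
lemma casimir_altSum {ae af ah : Module.End ℂ A} {e f h : Module.End ℂ B}
    {Um U Up : ℕ → A} {Z : ℕ → B} {n : ℕ} {N m β : ℂ}
    (hae : ∀ j ≤ n, ae (U j) = Um j + β • shiftSeq U j - shiftSeq (shiftSeq Up) j)
    (hah : ∀ j ≤ n, ah (U j) = (-2 * ((j : ℂ) + 1)) • Um (j + 1) + (β * (N - 2 * j)) • U j
      + (-2 * (N - j)) • shiftSeq Up j)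
    (haf : ∀ j ≤ n, af (U j) = (-(((j : ℂ) + 1) * (j + 2))) • Um (j + 2)
      + (β * (((j : ℂ) + 1) * (N - j))) • U (j + 1) + ((N - j) * (N - j - 1)) • Up j)
    (he : ∀ c ≤ n, e (Z c) = shiftSeq Z c)
    (hf : ∀ c : ℕ, f (Z c) = (((c : ℂ) + 1) * (m - c)) • Z (c + 1))
    (hh : ∀ c : ℕ, h (Z c) = (m - 2 * c) • Z c) :
    (TensorProduct.map ae f + TensorProduct.map af e + (2⁻¹ : ℂ) • TensorProduct.map ah h)
        (altSum U Z (fun _ _ => 1) n)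
      = (((n : ℂ) + 1) * (m - n)) • altSum Um Z (fun _ _ => 1) (n + 1)
        + (β * (N * (m - 2 * n) / 2 - n * (m - n + 1))) • altSum U Z (fun _ _ => 1) n
        + ((N - n) * (N + m - n + 1)) • shiftSeq (altSum Up Z (fun _ _ => 1)) n := by
  have expand :
      (TensorProduct.map ae f + TensorProduct.map af e + (2⁻¹ : ℂ) • TensorProduct.map ah h)
        (altSum U Z (fun _ _ => 1) n)
      = (altSum Um (fun c => Z (c + 1)) (fun _ y => (y + 1) * (m - y)) n
          + altSum (fun j => Um (j + 2)) (shiftSeq Z) (fun x _ => -((x + 1) * (x + 2))) n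
          + altSum (fun j => Um (j + 1)) Z (fun x y => -((x + 1) * (m - 2 * y))) n)
        + β • (altSum (shiftSeq U) (fun c => Z (c + 1)) (fun _ y => (y + 1) * (m - y)) n
          + altSum (fun j => U (j + 1)) (shiftSeq Z) (fun x _ => (x + 1) * (N - x)) n
          + altSum U Z (fun x y => (N - 2 * x) * (m - 2 * y) / 2) n)
        + (altSum (shiftSeq (shiftSeq Up)) (fun c => Z (c + 1))
              (fun _ y => -((y + 1) * (m - y))) n
          + altSum Up (shiftSeq Z) (fun x _ => (N - x) * (N - x - 1)) n
          + altSum (shiftSeq Up) Z (fun x y => -((N - x) * (m - 2 * y))) n) := by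
    simp only [altSum, map_sum, Finset.smul_sum, ← Finset.sum_add_distrib]
    refine Finset.sum_congr rfl fun p hp => ?_
    have hle := mem_antidiagonal.1 hp
    rw [map_smul, LinearMap.add_apply, LinearMap.add_apply, LinearMap.smul_apply,
      TensorProduct.map_tmul, TensorProduct.map_tmul, TensorProduct.map_tmul,
      hae _ (by omega), haf _ (by omega), hah _ (by omega), he _ (by omega), hf, hh]
    simp only [TensorProduct.add_tmul, TensorProduct.sub_tmul, TensorProduct.tmul_smul,
      ← TensorProduct.smul_tmul']
    module
  have hm : altSum Um (fun c => Z (c + 1)) (fun _ y => (y + 1) * (m - y)) n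
          + altSum (fun j => Um (j + 2)) (shiftSeq Z) (fun x _ => -((x + 1) * (x + 2))) n
          + altSum (fun j => Um (j + 1)) Z (fun x y => -((x + 1) * (m - 2 * y))) n
      = (((n : ℂ) + 1) * (m - n)) • altSum Um Z (fun _ _ => 1) (n + 1) := by
    rw [altSum_succ_right _ _ _ _ (by simp), altSum_succ_left (fun j => Um (j + 1)) _ _ _ (by simp),
      altSum_succ_left _ _ _ _ (by intro y; ring), altSum_shift_right,
      altSum_succ_left _ _ _ _ (by simp), altSum_add, altSum_add, altSum_smul]
    refine altSum_congr fun x y hxy => ?_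
    push_cast at hxy
    rw [eq_sub_of_add_eq hxy]
    ring
  have h0 : altSum (shiftSeq U) (fun c => Z (c + 1)) (fun _ y => (y + 1) * (m - y)) n
          + altSum (fun j => U (j + 1)) (shiftSeq Z) (fun x _ => (x + 1) * (N - x)) n
          + altSum U Z (fun x y => (N - 2 * x) * (m - 2 * y) / 2) n
      = (N * (m - 2 * n) / 2 - n * (m - n + 1)) • altSum U Z (fun _ _ => 1) n := by
    rw [altSum_succ_right _ _ _ _ (by simp), altSum_shift_left,
      altSum_succ_left _ _ _ _ (by simp), altSum_shift_right, altSum_add, altSum_add, altSum_smul]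
    refine altSum_congr fun x y hxy => ?_
    rw [eq_sub_of_add_eq hxy]
    ring
  have hp : altSum (shiftSeq (shiftSeq Up)) (fun c => Z (c + 1))
              (fun _ y => -((y + 1) * (m - y))) n
          + altSum Up (shiftSeq Z) (fun x _ => (N - x) * (N - x - 1)) n
          + altSum (shiftSeq Up) Z (fun x y => -((N - x) * (m - 2 * y))) n
      = ((N - n) * (N + m - n + 1)) • shiftSeq (altSum Up Z (fun _ _ => 1)) n := by
    cases n with
    | zero => simp [altSum, shiftSeq]
    | succ n =>
      rw [altSum_succ_right _ _ _ _ (by simp), altSum_shift_left, altSum_shift_left,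
        altSum_shift_right, altSum_shift_left, altSum_add, altSum_add, shiftSeq, altSum_smul]
      refine altSum_congr fun x y hxy => ?_
      rw [eq_sub_of_add_eq hxy]
      push_cast
      ring
  rw [expand, hm, h0, hp, smul_smul]

end AltSumShift

section Coupled

variable {A B : Type*} [AddCommGroup A] [Module ℂ A] [AddCommGroup B] [Module ℂ B]

/-- The diagonal action `a ⊗ 1 + 1 ⊗ b` on a tensor product. -/
noncomputable def diagAct (a : Module.End ℂ A) (b : Module.End ℂ B) : Module.End ℂ (A ⊗[ℂ] B) :=
  LinearMap.rTensor B a + LinearMap.lTensor A b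

lemma diagAct_tmul (a : Module.End ℂ A) (b : Module.End ℂ B) (x : A) (y : B) :
    diagAct a b (x ⊗ₜ y) = a x ⊗ₜ y + x ⊗ₜ b y := rfl

lemma IsSl2Action.diag {e₁ f₁ h₁ : Module.End ℂ A} {e₂ f₂ h₂ : Module.End ℂ B}
    (hsl1 : IsSl2Action e₁ f₁ h₁) (hsl2 : IsSl2Action e₂ f₂ h₂) :
    IsSl2Action (diagAct e₁ e₂) (diagAct f₁ f₂) (diagAct h₁ h₂) := by
  obtain ⟨p1, p2, p3⟩ := hsl1
  obtain ⟨q1, q2, q3⟩ := hsl2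
  refine ⟨?_, ?_, ?_⟩
  · refine TensorProduct.ext' fun x y => ?_
    have hx := LinearMap.congr_fun p1 x
    have hy := LinearMap.congr_fun q1 y
    simp only [LinearMap.sub_apply, LinearMap.comp_apply, LinearMap.smul_apply] at hx hy
    simp only [LinearMap.sub_apply, LinearMap.comp_apply, LinearMap.smul_apply, diagAct_tmul,
      map_add, eq_add_of_sub_eq hx, eq_add_of_sub_eq hy, TensorProduct.add_tmul,
      TensorProduct.tmul_add, TensorProduct.tmul_smul, ← TensorProduct.smul_tmul']
    module
  · refine TensorProduct.ext' fun x y => ?_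
    have hx := LinearMap.congr_fun p2 x
    have hy := LinearMap.congr_fun q2 y
    simp only [LinearMap.sub_apply, LinearMap.comp_apply, LinearMap.smul_apply] at hx hy
    simp only [LinearMap.sub_apply, LinearMap.comp_apply, LinearMap.smul_apply, diagAct_tmul,
      map_add, eq_add_of_sub_eq hx, eq_add_of_sub_eq hy, TensorProduct.add_tmul,
      TensorProduct.tmul_add, TensorProduct.tmul_smul, ← TensorProduct.smul_tmul']
    module
  · refine TensorProduct.ext' fun x y => ?_
    have hx := LinearMap.congr_fun p3 x
    have hy := LinearMap.congr_fun q3 y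
    simp only [LinearMap.sub_apply, LinearMap.comp_apply] at hx hy
    simp only [LinearMap.sub_apply, LinearMap.comp_apply, diagAct_tmul,
      map_add, eq_add_of_sub_eq hx, eq_add_of_sub_eq hy, TensorProduct.add_tmul,
      TensorProduct.tmul_add]
    abel

lemma diagAct_lTensor_comm (f₁ : Module.End ℂ A) {f₂ a b : Module.End ℂ B}
    (hab : ∀ y, a (f₂ y) = f₂ (a y) + b y) (x : A ⊗[ℂ] B) :
    LinearMap.lTensor A a (diagAct f₁ f₂ x)
      = diagAct f₁ f₂ (LinearMap.lTensor A a x) + LinearMap.lTensor A b x := by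
  induction x with
  | zero => simp
  | tmul x y =>
    simp only [diagAct_tmul, map_add, LinearMap.lTensor_tmul, hab, TensorProduct.tmul_add, add_assoc]
  | add x y hx hy =>
    simp only [map_add, hx, hy]
    abel

lemma diagAct_pow_tmul_eq_zero {f₁ : Module.End ℂ A} {f₂ : Module.End ℂ B} {v₁ : A} {v₂ : B}
    {m₁ m₂ : ℕ} (h₁ : (f₁ ^ (m₁ + 1)) v₁ = 0) (h₂ : (f₂ ^ (m₂ + 1)) v₂ = 0) (n : ℕ) :
    ∀ a b : ℕ, m₁ + m₂ + 1 ≤ n + a + b →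
      ((diagAct f₁ f₂) ^ n) ((f₁ ^ a) v₁ ⊗ₜ[ℂ] (f₂ ^ b) v₂) = 0 := by
  induction n with
  | zero =>
    intro a b hab
    rcases (by omega : m₁ + 1 ≤ a ∨ m₂ + 1 ≤ b) with h | h
    · rw [Module.End.pow_map_zero_of_le h h₁]; simp
    · rw [Module.End.pow_map_zero_of_le h h₂]; simp
  | succ n ih =>
    intro a b hab
    rw [pow_succ, Module.End.mul_apply, diagAct_tmul, map_add, ← Module.End.mul_apply f₁,
      ← Module.End.mul_apply f₂, ← pow_succ', ← pow_succ', ih _ _ (by omega), ih _ _ (by omega),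
      add_zero]

/-- The primitive vector `Σ (-1)^i f^i v₁ ⊗ f^{k-i} v₂ / ((m₁)_i (m₂)_{k-i} i! (k-i)!)`. -/
noncomputable def primVec (f₁ : Module.End ℂ A) (f₂ : Module.End ℂ B) (v₁ : A) (v₂ : B)
    (m₁ m₂ k : ℕ) : A ⊗[ℂ] B :=
  altSum (divString f₁ v₁ m₁) (divString f₂ v₂ m₂) (fun _ _ => 1) k

variable {e₁ f₁ h₁ : Module.End ℂ A} {e₂ f₂ h₂ : Module.End ℂ B} {v₁ : A} {v₂ : B} {m₁ m₂ : ℕ}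

lemma diagAct_lower_altSum (hv₁nil : (f₁ ^ (m₁ + 1)) v₁ = 0) (hv₂nil : (f₂ ^ (m₂ + 1)) v₂ = 0)
    (g : ℂ → ℂ → ℂ) (k : ℕ) :
    diagAct f₁ f₂ (altSum (divString f₁ v₁ m₁) (divString f₂ v₂ m₂) g k)
      = altSum (divString f₁ v₁ m₁) (divString f₂ v₂ m₂)
          (fun x y => y * (m₂ - y + 1) * g x (y - 1) - x * (m₁ - x + 1) * g (x - 1) y) (k + 1) := by
  rw [diagAct, LinearMap.add_apply,
    map_diag_shift_left (φ := fun x => (x + 1) * (m₁ - x)) (divString_lower f₁ v₁ m₁ hv₁nil) _ _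
      (by ring),
    map_diag_shift_right (φ := fun x => (x + 1) * (m₂ - x)) (divString_lower f₂ v₂ m₂ hv₂nil) _ _
      (by ring), altSum_add]
  exact altSum_congr fun x y _ => by ring

lemma diagAct_primVec_raise (hsl1 : IsSl2Action e₁ f₁ h₁) (hsl2 : IsSl2Action e₂ f₂ h₂)
    (hv₁e : e₁ v₁ = 0) (hv₁h : h₁ v₁ = (m₁ : ℂ) • v₁)
    (hv₂e : e₂ v₂ = 0) (hv₂h : h₂ v₂ = (m₂ : ℂ) • v₂)
    {k : ℕ} (hk₁ : k ≤ m₁) (hk₂ : k ≤ m₂) :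
    diagAct e₁ e₂ (primVec f₁ f₂ v₁ v₂ m₁ m₂ k) = 0 := by
  rw [diagAct, LinearMap.add_apply, primVec,
    map_raise_left fun b hb => divString_raise hsl1 hv₁e hv₁h (hb.trans hk₁),
    map_raise_right fun b hb => divString_raise hsl2 hv₂e hv₂h (hb.trans hk₂), neg_add_cancel]

lemma diagAct_primVec_weight (hsl1 : IsSl2Action e₁ f₁ h₁) (hsl2 : IsSl2Action e₂ f₂ h₂)
    (hv₁h : h₁ v₁ = (m₁ : ℂ) • v₁) (hv₂h : h₂ v₂ = (m₂ : ℂ) • v₂) (k : ℕ) :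
    diagAct h₁ h₂ (primVec f₁ f₂ v₁ v₂ m₁ m₂ k)
      = ((m₁ : ℂ) + m₂ - 2 * k) • primVec f₁ f₂ v₁ v₂ m₁ m₂ k := by
  rw [diagAct, LinearMap.add_apply, primVec,
    map_diag_left (φ := fun x => m₁ - 2 * x) (divString_weight hsl1 hv₁h),
    map_diag_right (φ := fun x => m₂ - 2 * x) (divString_weight hsl2 hv₂h), altSum_add, altSum_smul]
  exact altSum_congr fun x y hxy => by rw [← hxy]; ring

lemma diagAct_pow_primVec_eq_zero (hsl1 : IsSl2Action e₁ f₁ h₁) (hsl2 : IsSl2Action e₂ f₂ h₂)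
    (hv₁e : e₁ v₁ = 0) (hv₁h : h₁ v₁ = (m₁ : ℂ) • v₁) (hv₁nil : (f₁ ^ (m₁ + 1)) v₁ = 0)
    (hv₂e : e₂ v₂ = 0) (hv₂h : h₂ v₂ = (m₂ : ℂ) • v₂) (hv₂nil : (f₂ ^ (m₂ + 1)) v₂ = 0)
    {k M : ℕ} (hk₁ : k ≤ m₁) (hk₂ : k ≤ m₂) (hM : M + 2 * k = m₁ + m₂) :
    ((diagAct f₁ f₂) ^ (M + 1)) (primVec f₁ f₂ v₁ v₂ m₁ m₂ k) = 0 := by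
  have hMc : (m₁ : ℂ) + m₂ - 2 * k = M := by
    rw [sub_eq_iff_eq_add]; exact_mod_cast hM.symm
  refine pow_succ_eq_zero_of_primitive (hsl1.diag hsl2)
    (diagAct_primVec_raise hsl1 hsl2 hv₁e hv₁h hv₂e hv₂h hk₁ hk₂)
    (hMc ▸ diagAct_primVec_weight hsl1 hsl2 hv₁h hv₂h k) (n := 2 * k) ?_
  rw [primVec, altSum, map_sum]
  refine Finset.sum_eq_zero fun p _ => ?_
  rw [map_smul, divString, divString, TensorProduct.tmul_smul, ← TensorProduct.smul_tmul', map_smul,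
    map_smul, diagAct_pow_tmul_eq_zero hv₁nil hv₂nil _ _ _ (by omega)]
  simp

lemma diagAct_shift_primVec (hv₁nil : (f₁ ^ (m₁ + 1)) v₁ = 0) (hv₂nil : (f₂ ^ (m₂ + 1)) v₂ = 0)
    (k : ℕ) :
    diagAct f₁ f₂ (shiftSeq (primVec f₁ f₂ v₁ v₂ m₁ m₂) k)
      = altSum (divString f₁ v₁ m₁) (divString f₂ v₂ m₂)
          (fun _ y => y * (m₁ + m₂ - 2 * k + 2) - k * (m₁ - k + 1)) k := by
  cases k with
  | zero => simp [shiftSeq, altSum]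
  | succ k =>
    rw [shiftSeq, primVec, diagAct_lower_altSum hv₁nil hv₂nil]
    refine altSum_congr fun x y hxy => ?_
    rw [eq_sub_of_add_eq hxy]
    ring

lemma lTensor_raise_primVec (hsl2 : IsSl2Action e₂ f₂ h₂)
    (hv₂e : e₂ v₂ = 0) (hv₂h : h₂ v₂ = (m₂ : ℂ) • v₂) {k : ℕ} (hk₂ : k ≤ m₂) :
    LinearMap.lTensor A e₂ (primVec f₁ f₂ v₁ v₂ m₁ m₂ k)
      = shiftSeq (primVec f₁ f₂ v₁ v₂ m₁ m₂) k := by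
  rw [primVec, map_raise_right fun b hb => divString_raise hsl2 hv₂e hv₂h (hb.trans hk₂)]
  cases k <;> rfl

lemma lTensor_weight_primVec (hsl2 : IsSl2Action e₂ f₂ h₂)
    (hv₁nil : (f₁ ^ (m₁ + 1)) v₁ = 0)
    (hv₂h : h₂ v₂ = (m₂ : ℂ) • v₂) (hv₂nil : (f₂ ^ (m₂ + 1)) v₂ = 0)
    {k M : ℕ} (hM : M + 2 * k = m₁ + m₂) :
    LinearMap.lTensor A h₂ (primVec f₁ f₂ v₁ v₂ m₁ m₂ k)
      = (-2 / ((M : ℂ) + 2)) • diagAct f₁ f₂ (shiftSeq (primVec f₁ f₂ v₁ v₂ m₁ m₂) k)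
        + (m₂ - 2 * k * (m₁ - k + 1) / ((M : ℂ) + 2)) • primVec f₁ f₂ v₁ v₂ m₁ m₂ k := by
  have hMc : (m₁ : ℂ) + m₂ - 2 * k = M := by
    rw [sub_eq_iff_eq_add]; exact_mod_cast hM.symm
  have hM2 : (M : ℂ) + 2 ≠ 0 := by exact_mod_cast (M + 1).succ_ne_zero
  rw [diagAct_shift_primVec hv₁nil hv₂nil, primVec,
    map_diag_right (φ := fun x => m₂ - 2 * x) (divString_weight hsl2 hv₂h), altSum_smul, altSum_smul,
    altSum_add]
  refine altSum_congr fun x y _ => ?_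
  rw [hMc]
  field_simp
  ring

lemma lTensor_lower_primVec (hv₁nil : (f₁ ^ (m₁ + 1)) v₁ = 0) (hv₂nil : (f₂ ^ (m₂ + 1)) v₂ = 0)
    {k M : ℕ} (hk₁ : k ≤ m₁) (hk₂ : k ≤ m₂) (hM : M + 2 * k = m₁ + m₂) :
    LinearMap.lTensor A f₂ (primVec f₁ f₂ v₁ v₂ m₁ m₂ k)
      = (-1 / (((M : ℂ) + 2) * (M + 1))) •
          diagAct f₁ f₂ (diagAct f₁ f₂ (shiftSeq (primVec f₁ f₂ v₁ v₂ m₁ m₂) k))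
        + ((m₂ - 2 * k * (m₁ - k + 1) / ((M : ℂ) + 2)) / M) •
          diagAct f₁ f₂ (primVec f₁ f₂ v₁ v₂ m₁ m₂ k)
        + (((k : ℂ) + 1) * (m₁ - k) * (m₂ - k) * (m₁ + m₂ - k + 1) / (M * (M + 1))) •
          primVec f₁ f₂ v₁ v₂ m₁ m₂ (k + 1) := by
  have hM2 : (M : ℂ) + 2 ≠ 0 := by exact_mod_cast (M + 1).succ_ne_zero
  have hM1 : (M : ℂ) + 1 ≠ 0 := by exact_mod_cast M.succ_ne_zero
  rw [diagAct_shift_primVec hv₁nil hv₂nil, primVec, primVec, diagAct_lower_altSum hv₁nil hv₂nil,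
    diagAct_lower_altSum hv₁nil hv₂nil,
    map_diag_shift_right (φ := fun x => (x + 1) * (m₂ - x)) (divString_lower f₂ v₂ m₂ hv₂nil) _ _
      (by ring), altSum_smul, altSum_smul, altSum_smul, altSum_add, altSum_add]
  refine altSum_congr fun x y hxy => ?_
  push_cast at hxy
  rw [eq_sub_of_add_eq hxy]
  rcases Nat.eq_zero_or_pos M with rfl | hpos
  · obtain rfl : k = m₁ := by omega
    obtain rfl : k = m₂ := by omega
    push_cast
    simp only [zero_add, div_zero, zero_mul]
    field_simp
    ring
  · have hM0 : (M : ℂ) ≠ 0 := by exact_mod_cast hpos.ne'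
    have hMc : (m₂ : ℂ) = M + 2 * k - m₁ := by
      rw [eq_sub_iff_add_eq, add_comm]; exact_mod_cast hM.symm
    rw [hMc]
    field_simp
    ring

lemma lTensor_string_primVec (hsl1 : IsSl2Action e₁ f₁ h₁) (hsl2 : IsSl2Action e₂ f₂ h₂)
    (hv₁e : e₁ v₁ = 0) (hv₁h : h₁ v₁ = (m₁ : ℂ) • v₁) (hv₁nil : (f₁ ^ (m₁ + 1)) v₁ = 0)
    (hv₂e : e₂ v₂ = 0) (hv₂h : h₂ v₂ = (m₂ : ℂ) • v₂) (hv₂nil : (f₂ ^ (m₂ + 1)) v₂ = 0)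
    {k M : ℕ} (hk₁ : k ≤ m₁) (hk₂ : k ≤ m₂) (hM : M + 2 * k = m₁ + m₂)
    {Um U Up : ℕ → A ⊗[ℂ] B} {β : ℂ}
    (hUm : Um = divString (diagAct f₁ f₂) (shiftSeq (primVec f₁ f₂ v₁ v₂ m₁ m₂) k) ((M : ℂ) + 2))
    (hU : U = divString (diagAct f₁ f₂) (primVec f₁ f₂ v₁ v₂ m₁ m₂ k) M)
    (hUp : Up = fun j => (((k : ℂ) + 1) * (m₁ - k) * (m₂ - k) * (m₁ + m₂ - k + 1) /
        (((M : ℂ) - 1) * M ^ 2 * (M + 1))) •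
      divString (diagAct f₁ f₂) (primVec f₁ f₂ v₁ v₂ m₁ m₂ (k + 1)) ((M : ℂ) - 2) j)
    (hβ : β = (m₂ - 2 * k * (m₁ - k + 1) / ((M : ℂ) + 2)) / M)
    {j : ℕ} (hj : j ≤ M) :
    LinearMap.lTensor A e₂ (U j) = Um j + β • shiftSeq U j - shiftSeq (shiftSeq Up) j ∧
    LinearMap.lTensor A h₂ (U j) = (-2 * ((j : ℂ) + 1)) • Um (j + 1) + (β * (M - 2 * j)) • U j
      + (-2 * ((M : ℂ) - j)) • shiftSeq Up j ∧
    LinearMap.lTensor A f₂ (U j) = (-(((j : ℂ) + 1) * (j + 2))) • Um (j + 2)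
      + (β * (((j : ℂ) + 1) * (M - j))) • U (j + 1)
      + (((M : ℂ) - j) * (M - j - 1)) • Up j := by
  have hM2 : (M : ℂ) + 2 ≠ 0 := by exact_mod_cast (M + 1).succ_ne_zero
  have hM1 : (M : ℂ) + 1 ≠ 0 := by exact_mod_cast M.succ_ne_zero
  have hUlow : ∀ j : ℕ, diagAct f₁ f₂ (U j) = (((j : ℂ) + 1) * ((M : ℂ) - j)) • U (j + 1) := by
    subst hU
    exact divString_lower _ _ _
      (diagAct_pow_primVec_eq_zero hsl1 hsl2 hv₁e hv₁h hv₁nil hv₂e hv₂h hv₂nil hk₁ hk₂ hM)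
  have hU0 : U 0 = primVec f₁ f₂ v₁ v₂ m₁ m₂ k := by rw [hU, divString_zero]
  have hα : β * M = m₂ - 2 * k * (m₁ - k + 1) / ((M : ℂ) + 2) := by
    rw [hβ]
    rcases Nat.eq_zero_or_pos M with rfl | hpos
    · obtain rfl : k = m₁ := by omega
      obtain rfl : k = m₂ := by omega
      push_cast
      field_simp
      ring
    · rw [div_mul_cancel₀]
      exact_mod_cast hpos.ne'
  have hS : ((M : ℂ) * (M - 1)) * (((k : ℂ) + 1) * (m₁ - k) * (m₂ - k) * (m₁ + m₂ - k + 1) /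
        (((M : ℂ) - 1) * M ^ 2 * (M + 1)))
      = ((k : ℂ) + 1) * (m₁ - k) * (m₂ - k) * (m₁ + m₂ - k + 1) / (M * (M + 1)) := by
    rcases Nat.eq_zero_or_pos M with rfl | hpos
    · simp
    · have hM0 : (M : ℂ) ≠ 0 := by exact_mod_cast hpos.ne'
      by_cases h1 : M = 1
      · rcases (by omega : m₁ = k ∨ m₂ = k) with rfl | rfl <;> simp
      · have hMm : (M : ℂ) - 1 ≠ 0 := by rw [sub_ne_zero]; exact_mod_cast h1
        field_simp
  refine vector_operator_string (f := diagAct f₁ f₂) (fun x => ?_) (fun x => ?_) (fun x => ?_)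
    (fun j => ?_) hUlow (fun j => ?_) ?_ ?_ ?_ hj
  · have := diagAct_lTensor_comm f₁ (f₂ := f₂) (a := f₂) (b := 0) (fun y => by simp) x
    simpa using this
  · have := diagAct_lTensor_comm f₁ (f₂ := f₂) (a := h₂) (b := (-2 : ℂ) • f₂) (fun y => by
      have := LinearMap.congr_fun hsl2.2.1 y
      simp only [LinearMap.sub_apply, LinearMap.comp_apply] at this
      rw [← this]; abel) x
    rw [this, LinearMap.lTensor_smul, LinearMap.smul_apply]
    module
  · exact diagAct_lTensor_comm f₁ (f₂ := f₂) (a := e₂) (b := h₂) (fun y => by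
      have := LinearMap.congr_fun hsl2.2.2 y
      simp only [LinearMap.sub_apply, LinearMap.comp_apply] at this
      rw [← this]; abel) x
  · subst hUm
    cases k with
    | zero => simp [shiftSeq, divString_zero_vec]
    | succ k =>
      have := divString_lower _ _ (M + 2) (diagAct_pow_primVec_eq_zero hsl1 hsl2 hv₁e hv₁h hv₁nil
        hv₂e hv₂h hv₂nil (k := k) (M := M + 2) (by omega) (by omega) (by omega)) j
      push_cast at this
      exact this
  · subst hUp
    by_cases hk : k + 1 ≤ m₁ ∧ k + 1 ≤ m₂
    · obtain ⟨M', rfl⟩ : ∃ M', M = M' + 2 := ⟨M - 2, by omega⟩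
      have := divString_lower _ _ M' (diagAct_pow_primVec_eq_zero hsl1 hsl2 hv₁e hv₁h hv₁nil
        hv₂e hv₂h hv₂nil (k := k + 1) (M := M') (by omega) (by omega) (by omega)) j
      have hc : ((M' + 2 : ℕ) : ℂ) - 2 = M' := by push_cast; ring
      simp only [hc, map_smul, this]
      rw [smul_comm]
    · rcases (by omega : m₁ = k ∨ m₂ = k) with rfl | rfl <;> simp
  · rw [hU0, lTensor_raise_primVec hsl2 hv₂e hv₂h hk₂, hUm, divString_zero]
  · rw [hU0, lTensor_weight_primVec hsl2 hv₁nil hv₂h hv₂nil hM, hα]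
    congr 1
    rw [hUm, divString, smul_smul, pow_one]
    congr 1
    simp [fallFac]
    ring
  · rw [hU0, lTensor_lower_primVec hv₁nil hv₂nil hk₁ hk₂ hM, hUp]
    simp only [divString_zero]
    rw [smul_smul, hS, ← hU0, hUlow 0, hβ]
    congr 1
    congr 1
    · rw [hUm, divString, smul_smul, pow_two, Module.End.mul_apply]
      congr 1
      have hfac : fallFac ((M : ℂ) + 2) 2 = (M + 2) * (M + 1) := by
        simp only [fallFac, Finset.prod_range_succ, Finset.prod_range_zero]
        push_cast
        ring
      rw [hfac, Nat.factorial_two]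
      push_cast
      field_simp
    · rw [smul_smul]
      congr 1
      push_cast
      ring

end Coupled

lemma Wvec_eq_altSum {V₁ V₂ V₃ : Type*} [AddCommGroup V₁] [Module ℂ V₁]
    [AddCommGroup V₂] [Module ℂ V₂] [AddCommGroup V₃] [Module ℂ V₃]
    (f₁ : Module.End ℂ V₁) (f₂ : Module.End ℂ V₂) (f₃ : Module.End ℂ V₃)
    (v₁ : V₁) (v₂ : V₂) (v₃ : V₃) (m₁ m₂ m₃ r k : ℕ) :
    Wvec f₁ f₂ f₃ v₁ v₂ v₃ m₁ m₂ m₃ r k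
      = altSum (divString (diagAct f₁ f₂) (primVec f₁ f₂ v₁ v₂ m₁ m₂ k) ((m₁ : ℂ) + m₂ - 2 * k))
          (divString f₃ v₃ m₃) (fun _ _ => 1) (r - k) := by
  rw [Wvec, Finset.sum_comm, altSum, Finset.Nat.sum_antidiagonal_eq_sum_range_succ_mk]
  refine Finset.sum_congr rfl fun j _ => ?_
  rw [primVec, altSum, Finset.Nat.sum_antidiagonal_eq_sum_range_succ_mk]
  simp only [divString, map_sum, TensorProduct.sum_tmul, TensorProduct.tmul_smul,
    TensorProduct.smul_tmul', Finset.smul_sum, smul_smul]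
  refine Finset.sum_congr rfl fun i _ => ?_
  simp only [← TensorProduct.smul_tmul', map_smul, smul_smul]
  rw [diagAct, Ccoef, pow_add]
  congr 1
  simp only [one_div, mul_inv]
  ring

/-- The tridiagonal action of `Ω₂₃` on the (unnormalized) Shapovalov basis:
`Ω₂₃ W_{r₁} = (r−r₁+1)(m₃−r+r₁)·W_{r₁−1} + b_{r₁}·W_{r₁} + γ_{r₁}·W_{r₁+1}`. -/
theorem omega23_tridiagonal_on_Wvec
    {V₁ V₂ V₃ : Type*} [AddCommGroup V₁] [Module ℂ V₁]
    [AddCommGroup V₂] [Module ℂ V₂] [AddCommGroup V₃] [Module ℂ V₃]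
    (e₁ f₁ h₁ : Module.End ℂ V₁) (e₂ f₂ h₂ : Module.End ℂ V₂) (e₃ f₃ h₃ : Module.End ℂ V₃)
    (hsl1 : IsSl2Action e₁ f₁ h₁) (hsl2 : IsSl2Action e₂ f₂ h₂) (hsl3 : IsSl2Action e₃ f₃ h₃)
    (m₁ m₂ m₃ : ℕ) (v₁ : V₁) (v₂ : V₂) (v₃ : V₃)
    (hv₁e : e₁ v₁ = 0) (hv₁h : h₁ v₁ = (m₁ : ℂ) • v₁) (hv₁nil : (f₁ ^ (m₁ + 1)) v₁ = 0)
    (hv₂e : e₂ v₂ = 0) (hv₂h : h₂ v₂ = (m₂ : ℂ) • v₂) (hv₂nil : (f₂ ^ (m₂ + 1)) v₂ = 0)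
    (hv₃e : e₃ v₃ = 0) (hv₃h : h₃ v₃ = (m₃ : ℂ) • v₃) (hv₃nil : (f₃ ^ (m₃ + 1)) v₃ = 0)
    (r r₁ : ℕ) (hadm : Admissible m₁ m₂ m₃ r (r₁ : ℤ)) :
    Omega23Triple (V₁ := V₁) e₂ f₂ h₂ e₃ f₃ h₃ (WvecZ f₁ f₂ f₃ v₁ v₂ v₃ m₁ m₂ m₃ r (r₁ : ℤ)) =
      (((r : ℂ) - (r₁ : ℂ) + 1) * ((m₃ : ℂ) - (r : ℂ) + (r₁ : ℂ))) •
          WvecZ f₁ f₂ f₃ v₁ v₂ v₃ m₁ m₂ m₃ r ((r₁ : ℤ) - 1) +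
        ((m₂ : ℂ) * ((m₃ : ℂ) - 2 * (r : ℂ)) / 2 +
            (r₁ : ℂ) * ((m₂ : ℂ) - (m₃ : ℂ) + 2 * (r : ℂ) - 2 * (r₁ : ℂ)) +
            (r₁ : ℂ) * ((m₂ : ℂ) - (r₁ : ℂ) + 1) * ((r : ℂ) - (r₁ : ℂ) + 1) *
                ((m₃ : ℂ) - (r : ℂ) + (r₁ : ℂ)) /
              ((m₁ : ℂ) + (m₂ : ℂ) - 2 * (r₁ : ℂ) + 2) -
            ((r₁ : ℂ) + 1) * ((m₂ : ℂ) - (r₁ : ℂ)) * ((r : ℂ) - (r₁ : ℂ)) *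
                ((m₃ : ℂ) - (r : ℂ) + (r₁ : ℂ) + 1) /
              ((m₁ : ℂ) + (m₂ : ℂ) - 2 * (r₁ : ℂ))) •
          WvecZ f₁ f₂ f₃ v₁ v₂ v₃ m₁ m₂ m₃ r (r₁ : ℤ) +
        (((r₁ : ℂ) + 1) * ((m₁ : ℂ) - (r₁ : ℂ)) * ((m₂ : ℂ) - (r₁ : ℂ)) *
            ((m₁ : ℂ) + (m₂ : ℂ) - (r₁ : ℂ) + 1) *
            ((m₁ : ℂ) + (m₂ : ℂ) - (r : ℂ) - (r₁ : ℂ)) *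
            ((m₁ : ℂ) + (m₂ : ℂ) + (m₃ : ℂ) - (r : ℂ) - (r₁ : ℂ) + 1) /
          (((m₁ : ℂ) + (m₂ : ℂ) - 2 * (r₁ : ℂ) - 1) *
            ((m₁ : ℂ) + (m₂ : ℂ) - 2 * (r₁ : ℂ)) ^ 2 *
            ((m₁ : ℂ) + (m₂ : ℂ) - 2 * (r₁ : ℂ) + 1))) •
          WvecZ f₁ f₂ f₃ v₁ v₂ v₃ m₁ m₂ m₃ r ((r₁ : ℤ) + 1) := by
  have hadm' := hadm
  obtain ⟨had1, -, had3, had4, had5, had6⟩ := hadm'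
  obtain ⟨n, rfl⟩ : ∃ n, r = r₁ + n := ⟨r - r₁, by omega⟩
  obtain ⟨M, hM⟩ : ∃ M, M + 2 * r₁ = m₁ + m₂ := ⟨m₁ + m₂ - 2 * r₁, by omega⟩
  have hMc : (m₁ : ℂ) + m₂ - 2 * r₁ = M := by
    rw [sub_eq_iff_eq_add]; exact_mod_cast hM.symm
  have hm₂ : (m₂ : ℂ) = M + 2 * r₁ - m₁ := by rw [← hMc]; ring
  have hM2 : (M : ℂ) + 2 ≠ 0 := by exact_mod_cast (M + 1).succ_ne_zero
  have hΩ : Omega23Triple (V₁ := V₁) e₂ f₂ h₂ e₃ f₃ h₃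
      = TensorProduct.map (LinearMap.lTensor V₁ e₂) f₃
        + TensorProduct.map (LinearMap.lTensor V₁ f₂) e₃
        + (2⁻¹ : ℂ) • TensorProduct.map (LinearMap.lTensor V₁ h₂) h₃ := rfl
  have string := fun (j : ℕ) (hj : j ≤ n) =>
    lTensor_string_primVec hsl1 hsl2 hv₁e hv₁h hv₁nil hv₂e hv₂h hv₂nil
      (by omega : r₁ ≤ m₁) (by omega : r₁ ≤ m₂) hM rfl rfl rfl rfl (by omega : j ≤ M)
  have key := casimir_altSum (fun j hj => (string j hj).1) (fun j hj => (string j hj).2.1)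
    (fun j hj => (string j hj).2.2)
    (fun c hc => divString_raise hsl3 hv₃e hv₃h (by omega : c ≤ m₃))
    (divString_lower f₃ v₃ m₃ hv₃nil) (divString_weight hsl3 hv₃h)
  have hW : WvecZ f₁ f₂ f₃ v₁ v₂ v₃ m₁ m₂ m₃ (r₁ + n) (r₁ : ℤ)
      = altSum (divString (diagAct f₁ f₂) (primVec f₁ f₂ v₁ v₂ m₁ m₂ r₁) M)
          (divString f₃ v₃ m₃) (fun _ _ => 1) n := by
    rw [WvecZ, if_pos hadm, Int.toNat_natCast, Wvec_eq_altSum, hMc, Nat.add_sub_cancel_left]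
  rw [hΩ, hW, key]
  congr 1
  · congr 1
    · cases r₁ with
      | zero =>
        rw [WvecZ, if_neg (by intro h; have := h.2.1; omega)]
        simp [shiftSeq, altSum, divString_zero_vec]
      | succ k =>
        have hcoef : (((k + 1 + n : ℕ) : ℂ) - ((k + 1 : ℕ) : ℂ) + 1)
            * ((m₃ : ℂ) - ((k + 1 + n : ℕ) : ℂ) + ((k + 1 : ℕ) : ℂ)) = ((n : ℂ) + 1) * (m₃ - n) := by
          push_cast; ring
        rw [hcoef]
        by_cases hn : n = m₃
        · simp [hn]
        · have hk : ((k + 1 : ℕ) : ℤ) - 1 = (k : ℤ) := by push_cast; ring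
          rw [hk, WvecZ, if_pos ⟨by omega, by omega, by omega, by omega, by omega, by omega⟩,
            Int.toNat_natCast, Wvec_eq_altSum, (by omega : k + 1 + n - k = n + 1), shiftSeq, ← hMc]
          congr 4
          push_cast
          ring
    · congr 1
      rw [hMc]
      rcases Nat.eq_zero_or_pos M with rfl | hpos
      · obtain rfl : r₁ = m₁ := by omega
        obtain rfl : r₁ = m₂ := by omega
        obtain rfl : n = 0 := by omega
        push_cast
        simp only [add_zero, sub_self, div_zero, zero_mul, mul_zero]
        field_simp
        ring
      · have hM0 : (M : ℂ) ≠ 0 := by exact_mod_cast hpos.ne'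
        rw [hm₂]
        push_cast
        field_simp
        ring
  · cases n with
    | zero =>
      rw [WvecZ, if_neg (by intro h; have := h.2.2.1; omega)]
      simp [shiftSeq]
    | succ n =>
      rw [shiftSeq, altSum_smul_left, smul_smul, hMc]
      by_cases hk : r₁ + 1 ≤ m₁ ∧ r₁ + 1 ≤ m₂ ∧ n + 1 < M
      · have hk' : (r₁ : ℤ) + 1 = ((r₁ + 1 : ℕ) : ℤ) := by push_cast; ring
        rw [hk', WvecZ, if_pos ⟨by omega, by omega, by omega, by omega, by omega, by omega⟩,
          Int.toNat_natCast, Wvec_eq_altSum, (by omega : r₁ + (n + 1) - (r₁ + 1) = n), ← hMc]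
        congr 1
        · push_cast
          ring
        · congr 2
          push_cast
          ring
      · rcases (by omega : r₁ = m₁ ∨ r₁ = m₂ ∨ n + 1 = M) with h | h | h
        · simp [h]
        · simp [h]
        · have h1 : (M : ℂ) - ((n + 1 : ℕ) : ℂ) = 0 := by rw [h, sub_self]
          have h2 : (m₁ : ℂ) + m₂ - ((r₁ + (n + 1) : ℕ) : ℂ) - r₁ = 0 := by
            rw [← h1, ← hMc]; push_cast; ring
          rw [h1, h2]
          simp
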